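/- Let K be a field of characteristic 0 and let J : K[x] → K[x] be the K-linear integration operator with J(xⁿ) = xⁿ⁺¹/(n+1). For every n ≥ 1, the bracket [a, b]ₙ = Σ_{i=0}^{n} C(n,i)·(1 − 2i/n)·Jⁱ(a)·Jⁿ⁻ⁱ(b) on K[x] is anticommutative and satisfies the Tortkara identity [[a, b], [c, d]] + [[a, d], [c, b]] = [jac(a, b, c), d] + [jac(a, d, c), b], where all brackets are [·,·]ₙ and jac(a, b, c) = [[a, b], c] + [[b, c], a] + [[c, a], b]. -/

import Mathlib

open Polynomial

/-- The bracket `[a, b]ₙ = Σ_{i=0}^{n} C(n,i)·(1 − 2i/n) • (Jⁱ a * Jⁿ⁻ⁱ b)`. -/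
noncomputable def brkN {K : Type*} [Field K]
    (J : Polynomial K →ₗ[K] Polynomial K) (n : ℕ) (a b : Polynomial K) : Polynomial K :=
  ∑ i ∈ Finset.range (n + 1),
    ((n.choose i : K) * (1 - 2 * (i : K) / (n : K))) • ((J ^ i) a * (J ^ (n - i)) b)

/-- The Jacobian `jac(a, b, c) = [[a, b], c] + [[b, c], a] + [[c, a], b]` of `[·,·]ₙ`. -/
noncomputable def jacN {K : Type*} [Field K]
    (J : Polynomial K →ₗ[K] Polynomial K) (n : ℕ) (a b c : Polynomial K) : Polynomial K :=
  brkN J n (brkN J n a b) c + brkN J n (brkN J n b c) a + brkN J n (brkN J n c a) b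

lemma my_dJ {K : Type*} [Field K] [CharZero K]
    (J : Polynomial K →ₗ[K] Polynomial K)
    (hJ : ∀ m : ℕ, J (X ^ m) = (((m : K) + 1)⁻¹) • X ^ (m + 1)) (p : Polynomial K) :
    derivative (J p) = p ∧ (J p).coeff 0 = 0 := by
  induction p using Polynomial.induction_on' with
  | add p q hp hq => simp [hp.1, hp.2, hq.1, hq.2]
  | monomial m a =>
    have h : ((m : K) + 1) ≠ 0 := by exact_mod_cast Nat.succ_ne_zero m
    have : monomial m a = a • (X ^ m : Polynomial K) := by
      rw [← C_mul_X_pow_eq_monomial, smul_eq_C_mul]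
    rw [this, map_smul, hJ]
    constructor
    · rw [derivative_smul, derivative_smul, derivative_X_pow]
      congr 1
      rw [smul_eq_C_mul, ← mul_assoc, ← C_mul]
      push_cast
      rw [inv_mul_cancel₀ h]
      simp
    · simp

lemma my_RB {K : Type*} [Field K] [CharZero K]
    (J : Polynomial K →ₗ[K] Polynomial K)
    (hJ : ∀ m : ℕ, J (X ^ m) = (((m : K) + 1)⁻¹) • X ^ (m + 1)) (p q : Polynomial K) :
    J p * J q = J (p * J q) + J (J p * q) := by
  rw [← sub_eq_zero]
  set r := J p * J q - (J (p * J q) + J (J p * q)) with hr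
  have h1 : derivative r = 0 := by
    simp only [hr, derivative_sub, derivative_add, derivative_mul, (my_dJ J hJ _).1]
    ring
  have h0 : r.coeff 0 = 0 := by
    simp only [hr, coeff_sub, coeff_add, mul_coeff_zero, (my_dJ J hJ _).2]
    simp
  have := Polynomial.derivative_eq_zero.1 h1
  rw [eq_C_of_natDegree_eq_zero this, h0, C_0]

/-- auxiliary binomial sum -/
noncomputable def myT {K : Type*} [Field K]
    (J : Polynomial K →ₗ[K] Polynomial K) (m : ℕ) (a b : Polynomial K) : Polynomial K :=
  ∑ i ∈ Finset.range (m + 1), (m.choose i : K) • ((J ^ i) a * (J ^ (m - i)) b)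

lemma my_split {K M : Type*} [Field K] [AddCommGroup M] [Module K M] (e : K) (m : ℕ)
    (c : ℕ → K) (f : ℕ → ℕ → M) (h0 : c 0 = 1)
    (hc : ∀ i, c (i + 1) = (m.choose (i + 1) : K) + e * (m.choose i : K)) :
    ∑ i ∈ Finset.range (m + 1 + 1), c i • f i (m + 1 - i) =
      ∑ i ∈ Finset.range (m + 1), (m.choose i : K) • f i (m - i + 1) +
      e • ∑ i ∈ Finset.range (m + 1), (m.choose i : K) • f (i + 1) (m - i) := by
  have h1 : ∑ i ∈ Finset.range (m + 1), (m.choose i : K) • f i (m - i + 1) =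
      ∑ i ∈ Finset.range (m + 1 + 1), (m.choose i : K) • f i (m + 1 - i) := by
    rw [Finset.sum_range_succ _ (m + 1)]
    simp only [Nat.choose_succ_self, Nat.cast_zero, zero_smul, add_zero]
    refine Finset.sum_congr rfl fun i hi => ?_
    rw [Nat.sub_add_comm (by simpa [Nat.lt_succ_iff] using hi)]
  rw [h1, Finset.sum_range_succ', Finset.sum_range_succ' _ (m + 1), Finset.smul_sum]
  simp only [hc, h0, add_smul, Finset.sum_add_distrib, mul_smul, Nat.add_sub_add_right]
  simp
  abel

lemma my_T_succ {K : Type*} [Field K]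
    (J : Polynomial K →ₗ[K] Polynomial K) (m : ℕ) (a b : Polynomial K) :
    myT J (m + 1) a b = myT J m a (J b) + myT J m (J a) b := by
  have := my_split (K := K) 1 m (fun i => ((m + 1).choose i : K))
    (fun i j => (J ^ i) a * (J ^ j) b) (by simp)
    (fun i => by rw [Nat.choose_succ_succ]; push_cast; ring)
  simpa [myT, pow_succ] using this

lemma my_brk {K : Type*} [Field K] [CharZero K]
    (J : Polynomial K →ₗ[K] Polynomial K) (m : ℕ) (a b : Polynomial K) :
    brkN J (m + 1) a b = myT J m a (J b) - myT J m (J a) b := by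
  have := my_split (K := K) (-1) m
    (fun i => ((m + 1).choose i : K) * (1 - 2 * (i : K) / ((m + 1 : ℕ) : K)))
    (fun i j => (J ^ i) a * (J ^ j) b) (by simp)
    (fun i => by
      have h : ((m : K) + 1) ≠ 0 := by exact_mod_cast Nat.succ_ne_zero m
      have h2 : ((m : K) + 1) * (m.choose i : K) = ((m + 1).choose (i + 1) : K) * (i + 1) := by
        exact_mod_cast Nat.add_one_mul_choose_eq m i
      have h3 : ((m + 1).choose (i + 1) : K) = m.choose i + m.choose (i + 1) := by
        rw [Nat.choose_succ_succ]; push_cast; ring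
      push_cast
      field_simp
      linear_combination (m + 1 : K) * h3 + 2 * h2)
  rw [brkN, this]
  simp [myT, pow_succ, sub_eq_add_neg]

lemma my_JT {K : Type*} [Field K] [CharZero K]
    (J : Polynomial K →ₗ[K] Polynomial K)
    (hJ : ∀ m : ℕ, J (X ^ m) = (((m : K) + 1)⁻¹) • X ^ (m + 1)) (m : ℕ) :
    ∀ a b : Polynomial K, (J ^ m) (myT J m a b) = (J ^ m) a * (J ^ m) b := by
  induction m with
  | zero => intro a b; simp [myT]
  | succ m ih =>
    intro a b
    have hc : ∀ p, (J ^ m) (J p) = J ((J ^ m) p) := fun p => by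
      rw [← Module.End.mul_apply, ← Module.End.mul_apply, ← pow_succ, ← pow_succ']
    rw [pow_succ', Module.End.mul_apply, Module.End.mul_apply, Module.End.mul_apply,
      my_T_succ, map_add, ih, ih, hc, hc, map_add, my_RB J hJ]

lemma my_tort {M : Type*} [AddCommGroup M] (z : M →+ M →+ M)
    (hz : ∀ a b c, z (z a b) c = z a (z b c) + z a (z c b))
    (B : M → M → M) (hB : ∀ a b, B a b = z a b - z b a) (a b c d : M) :
    B (B a b) (B c d) + B (B a d) (B c b) =
      B (B (B a b) c + B (B b c) a + B (B c a) b) d +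
      B (B (B a d) c + B (B d c) a + B (B c a) d) b := by
  simp only [hB, map_add, map_sub, AddMonoidHom.add_apply, AddMonoidHom.sub_apply, hz]
  abel

theorem stmt_13 (K : Type*) [Field K] [CharZero K]
    (J : Polynomial K →ₗ[K] Polynomial K)
    (hJ : ∀ m : ℕ, J (X ^ m) = (((m : K) + 1)⁻¹) • X ^ (m + 1))
    (n : ℕ) (hn : 1 ≤ n) :
    (∀ a b : Polynomial K, brkN J n a b = -brkN J n b a) ∧
    (∀ a b c d : Polynomial K,
      brkN J n (brkN J n a b) (brkN J n c d) + brkN J n (brkN J n a d) (brkN J n c b) =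
        brkN J n (jacN J n a b c) d + brkN J n (jacN J n a d c) b) := by
  obtain ⟨m, rfl⟩ : ∃ m, n = m + 1 := ⟨n - 1, by omega⟩
  have inj1 : Function.Injective J := fun p q h => by
    rw [← (my_dJ J hJ p).1, h, (my_dJ J hJ q).1]
  have inj : Function.Injective (J ^ m) := by
    rw [Module.End.coe_pow]; exact inj1.iterate m
  have hc : ∀ p, (J ^ m) (J p) = J ((J ^ m) p) := fun p => by
    rw [← Module.End.mul_apply, ← Module.End.mul_apply, ← pow_succ, ← pow_succ']
  let z : Polynomial K →+ Polynomial K →+ Polynomial K :=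
    AddMonoidHom.mk' (fun a => AddMonoidHom.mk' (fun b => a * J b)
      (fun x y => by rw [map_add, mul_add])) (fun x y => by
        refine AddMonoidHom.ext fun t => ?_
        simp [add_mul])
  have zdef : ∀ a b, z a b = a * J b := fun _ _ => rfl
  have key : ∀ a b, (J ^ m) (brkN J (m + 1) a b) =
      z ((J ^ m) a) ((J ^ m) b) - z ((J ^ m) b) ((J ^ m) a) := fun a b => by
    rw [my_brk, map_sub, my_JT J hJ, my_JT J hJ, hc, hc, zdef, zdef]
    ring
  constructor
  · intro a b
    apply inj
    rw [map_neg, key, key]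
    abel
  · intro a b c d
    apply inj
    have := my_tort z (fun a b c => by
      simp only [zdef]
      rw [mul_assoc, my_RB J hJ, mul_add, mul_comm (J b) c]) (fun a b => z a b - z b a)
      (fun _ _ => rfl) ((J ^ m) a) ((J ^ m) b) ((J ^ m) c) ((J ^ m) d)
    simp only [jacN, map_add (J ^ m), key]
    exact this
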